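/- arXiv:1911.03617 — 2 statements merged into one kernel-verified Lean document; each statement's English description precedes it below -/
import Mathlib

section
/- Let (Ω, 𝔉, P) be a probability space and let 𝒢' ⊆ 𝒢 ⊆ ℱ ⊆ 𝔉 be sub-σ-algebras. Let d, m ∈ ℕ, A a d×d real matrix, B a d×m real matrix. Let x', w : Ω → ℝ^d be integrable, u : Ω → ℝ^m integrable and 𝒢-measurable, and set x := A x' + B u + w (pointwise). Let x̂ := E[x | ℱ], and let s : Ω → {0,1} be 𝒢-measurable such that the function s·x̂ is 𝒢-measurable. Assume (1−s)·E[w | 𝒢] = 0 almost surely and (1−s)·E[x' | 𝒢] = (1−s)·E[x' | 𝒢'] almost surely. Then E[x | 𝒢] = s·x̂ + (1−s)·(A·E[x' | 𝒢'] + B·u) almost surely. -/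
open MeasureTheory

/-- Lemma 1 (abstract form): the optimal remote estimator under a Bernoulli
sensor-channel dropout satisfies
`E[x | 𝒢] = s x̂ + (1 − s)(A E[x' | 𝒢'] + B u)` a.s. -/
theorem remote_estimator_recursion
    {Ω : Type*} {m0 : MeasurableSpace Ω} {μ : Measure Ω} [IsProbabilityMeasure μ]
    {d m : ℕ}
    {G' G F : MeasurableSpace Ω} (hG'G : G' ≤ G) (hGF : G ≤ F) (hFm0 : F ≤ m0)
    (A : Matrix (Fin d) (Fin d) ℝ) (B : Matrix (Fin d) (Fin m) ℝ)
    (x' w : Ω → Fin d → ℝ) (u : Ω → Fin m → ℝ)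
    (hx'_int : Integrable x' μ) (hw_int : Integrable w μ) (hu_int : Integrable u μ)
    (hu_meas : StronglyMeasurable[G] u)
    (x : Ω → Fin d → ℝ)
    (hx : ∀ ω, x ω = A.mulVec (x' ω) + B.mulVec (u ω) + w ω)
    (s : Ω → ℝ) (hs01 : ∀ ω, s ω = 0 ∨ s ω = 1) (hs_meas : Measurable[G] s)
    (hs_xhat_meas : StronglyMeasurable[G] (fun ω => s ω • (μ[x | F]) ω))
    (hw0 : ∀ᵐ ω ∂μ, (1 - s ω) • (μ[w | G]) ω = 0)
    (hx'_pred : ∀ᵐ ω ∂μ, (1 - s ω) • (μ[x' | G]) ω = (1 - s ω) • (μ[x' | G']) ω) :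
    ∀ᵐ ω ∂μ, (μ[x | G]) ω =
      s ω • (μ[x | F]) ω
        + (1 - s ω) • (A.mulVec ((μ[x' | G']) ω) + B.mulVec (u ω)) := by
  have hGm0 : G ≤ m0 := hGF.trans hFm0
  let LA : (Fin d → ℝ) →L[ℝ] (Fin d → ℝ) := LinearMap.toContinuousLinearMap A.mulVecLin
  let LB : (Fin m → ℝ) →L[ℝ] (Fin d → ℝ) := LinearMap.toContinuousLinearMap B.mulVecLin
  have hLA : ∀ v, LA v = A.mulVec v := fun v => rfl
  have hLB : ∀ v, LB v = B.mulVec v := fun v => rfl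
  have hAi : Integrable (LA ∘ x') μ := LA.integrable_comp hx'_int
  have hBi : Integrable (LB ∘ u) μ := LB.integrable_comp hu_int
  have hxe : x = LA ∘ x' + LB ∘ u + w := by
    funext ω
    exact hx ω
  have h1 : μ[x | G] =ᵐ[μ] μ[LA ∘ x' + LB ∘ u | G] + μ[w | G] := by
    rw [hxe]
    exact condExp_add (hAi.add hBi) hw_int G
  have h2 : μ[LA ∘ x' + LB ∘ u | G] =ᵐ[μ] μ[LA ∘ x' | G] + μ[LB ∘ u | G] :=
    condExp_add hAi hBi G
  have h3 : LA ∘ μ[x' | G] =ᵐ[μ] μ[LA ∘ x' | G] := LA.comp_condExp_comm hx'_int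
  have h4 : μ[LB ∘ u | G] = LB ∘ u :=
    condExp_of_stronglyMeasurable hGm0 (LB.continuous.comp_stronglyMeasurable hu_meas) hBi
  have hsi : Integrable (s • μ[x | F]) μ := by
    refine Integrable.mono (integrable_condExp (f := x) (m := F) (μ := μ))
      (hs_xhat_meas.mono hGm0).aestronglyMeasurable (Filter.Eventually.of_forall fun ω => ?_)
    rcases hs01 ω with h | h <;> simp [h]
  have h5 : μ[s • μ[x | F] | G] = s • μ[x | F] :=
    condExp_of_stronglyMeasurable hGm0 hs_xhat_meas hsi
  have h6 : μ[s • μ[x | F] | G] =ᵐ[μ] s • μ[μ[x | F] | G] :=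
    condExp_smul_of_aestronglyMeasurable_left
      hs_meas.stronglyMeasurable.aestronglyMeasurable hsi integrable_condExp
  have h7 : μ[μ[x | F] | G] =ᵐ[μ] μ[x | G] := condExp_condExp_of_le hGF hFm0
  rw [h5] at h6
  filter_upwards [h1, h2, h3, h6, h7, hw0, hx'_pred] with ω h1 h2 h3 h6 h7 h8 h9
  simp only [Pi.add_apply, Pi.smul_apply', Function.comp_apply] at h1 h2 h3 h6
  rcases hs01 ω with h | h
  · simp only [h, sub_zero, one_smul, zero_smul, zero_add] at h8 h9 ⊢
    rw [h1, h2, ← h3, h4, h8, h9, add_zero]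
    rfl
  · simp only [h, one_smul, sub_self, zero_smul, add_zero] at h6 ⊢
    rw [h6, h7]
end

section
/- Let A be a d×d real matrix, P a symmetric positive definite d×d matrix, λ₁ > 0 with Aᵀ P A ⪯ λ₁ P in the Loewner order, and p ∈ (0,1] such that λ := (1−p)·λ₁ < 1. Let (e_t)_{t∈ℕ}, (v_t)_{t∈ℕ} be ℝ^d-valued random processes and (s_t)_{t≥1} random variables with values in {0,1} and P(s_{t+1} = 1) = p for every t, satisfying e_{t+1} = (1 − s_{t+1})·(A e_t + v_t) for every t. Assume that for every t the three random objects s_{t+1}, v_t, e_t are mutually independent, E[v_t] = 0, E[v_tᵀ P v_t] ≤ C₁, and E[e_0ᵀ P e_0] < ∞. Then for every t, E[e_tᵀ P e_t] ≤ λᵗ · E[e_0ᵀ P e_0] + C₁/(1−λ); in particular sup_t E[‖e_t‖²] < ∞. -/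
open MeasureTheory ProbabilityTheory Matrix Finset

lemma quad_nonneg_aux {d : ℕ} {P : Matrix (Fin d) (Fin d) ℝ} (hP : P.PosSemidef)
    (x : Fin d → ℝ) : 0 ≤ x ⬝ᵥ P.mulVec x := by
  simpa using hP.dotProduct_mulVec_nonneg x

lemma quad_add_aux {d : ℕ} {P : Matrix (Fin d) (Fin d) ℝ} (hs : P.IsSymm)
    (x y : Fin d → ℝ) : (x + y) ⬝ᵥ P.mulVec (x + y)
      = x ⬝ᵥ P.mulVec x + 2 * (P.mulVec x ⬝ᵥ y) + y ⬝ᵥ P.mulVec y := by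
  have h : x ⬝ᵥ P.mulVec y = P.mulVec x ⬝ᵥ y := by
    rw [dotProduct_mulVec, ← mulVec_transpose, hs.eq]
  rw [mulVec_add, add_dotProduct, dotProduct_add, dotProduct_add, h,
    dotProduct_comm y (P.mulVec x)]
  ring

lemma quad_smul_aux {d : ℕ} (P : Matrix (Fin d) (Fin d) ℝ) (c : ℝ)
    (x : Fin d → ℝ) : (c • x) ⬝ᵥ P.mulVec (c • x) = c ^ 2 * (x ⬝ᵥ P.mulVec x) := by
  rw [mulVec_smul, smul_dotProduct, dotProduct_smul, smul_eq_mul, smul_eq_mul]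
  ring

lemma coord_sq_aux {d : ℕ} {P : Matrix (Fin d) (Fin d) ℝ} (hs : P.IsSymm)
    (hP : P.PosDef) (i : Fin d) : ∃ K : ℝ, 0 ≤ K ∧
      ∀ x : Fin d → ℝ, x i ^ 2 ≤ K * (x ⬝ᵥ P.mulVec x) := by
  have hu : IsUnit P.det := hP.det_pos.ne'.isUnit
  set y : Fin d → ℝ := P⁻¹.mulVec (Pi.single i 1) with hy
  have hPy : P.mulVec y = Pi.single i 1 := by
    rw [hy, mulVec_mulVec, mul_nonsing_inv _ hu, one_mulVec]
  refine ⟨y ⬝ᵥ P.mulVec y, quad_nonneg_aux hP.posSemidef y, fun x => ?_⟩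
  have key : ∀ r : ℝ, 0 ≤ (y ⬝ᵥ P.mulVec y) * (r * r) + (2 * x i) * r + x ⬝ᵥ P.mulVec x := by
    intro r
    have h := quad_nonneg_aux hP.posSemidef (r • y + x)
    rw [quad_add_aux hs, quad_smul_aux, mulVec_smul, smul_dotProduct, hPy] at h
    rw [hPy]
    simp only [single_dotProduct, smul_eq_mul, one_mul] at h
    nlinarith
  have := discrim_le_zero key
  unfold discrim at this
  nlinarith

lemma quad_A_aux {d : ℕ} {A P : Matrix (Fin d) (Fin d) ℝ} {l : ℝ}
    (h : (l • P - Aᵀ * P * A).PosSemidef) (x : Fin d → ℝ) :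
    A.mulVec x ⬝ᵥ P.mulVec (A.mulVec x) ≤ l * (x ⬝ᵥ P.mulVec x) := by
  have h1 := quad_nonneg_aux h x
  rw [sub_mulVec, dotProduct_sub, smul_mulVec, dotProduct_smul, smul_eq_mul,
    ← mulVec_mulVec, ← mulVec_mulVec, dotProduct_mulVec x Aᵀ, vecMul_transpose] at h1
  linarith

lemma quad_meas_aux {Ω : Type*} {m0 : MeasurableSpace Ω} {d : ℕ}
    (B C : Matrix (Fin d) (Fin d) ℝ) {x y : Ω → Fin d → ℝ} (hx : Measurable x)
    (hy : Measurable y) :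
    Measurable (fun ω => B.mulVec (x ω) ⬝ᵥ C.mulVec (y ω)) := by
  unfold dotProduct mulVec dotProduct
  fun_prop

lemma indep_aux {Ω : Type*} {m0 : MeasurableSpace Ω} {μ : Measure Ω}
    {d : ℕ} (e v : Ω → Fin d → ℝ) (s : Ω → ℝ)
    (he : Measurable e) (hv : Measurable v) (hs : Measurable s)
    (h : iIndep ![MeasurableSpace.comap s inferInstance,
               MeasurableSpace.comap v inferInstance,
               MeasurableSpace.comap e inferInstance] μ) :
    IndepFun v e μ ∧ IndepFun s (fun ω => (v ω, e ω)) μ := by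
  constructor
  · have := h.indep (i := 1) (j := 2) (by decide)
    exact this
  · have hle : ∀ i, ![MeasurableSpace.comap s inferInstance,
               MeasurableSpace.comap v inferInstance,
               MeasurableSpace.comap e inferInstance] i ≤ m0 := by
      intro i
      fin_cases i
      · exact hs.comap_le
      · exact hv.comap_le
      · exact he.comap_le
    have h2 := indep_iSup_of_disjoint hle h (S := {0}) (T := {1, 2}) (by simp)
    rw [IndepFun_iff_Indep]
    refine indep_of_indep_of_le_left (indep_of_indep_of_le_right h2 ?_) ?_
    · rw [← measurable_iff_comap_le]
      refine Measurable.prodMk ?_ ?_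
      · rw [measurable_iff_comap_le]
        exact le_iSup₂_of_le (1 : Fin 3) (by simp) le_rfl
      · rw [measurable_iff_comap_le]
        exact le_iSup₂_of_le (2 : Fin 3) (by simp) le_rfl
    · exact le_iSup₂_of_le (0 : Fin 3) (by simp) le_rfl

lemma one_sub_aux {Ω : Type*} {m0 : MeasurableSpace Ω} {μ : Measure Ω}
    [IsProbabilityMeasure μ] (s : Ω → ℝ) (hs : Measurable s)
    (h01 : ∀ ω, s ω = 0 ∨ s ω = 1) (p : ℝ) (hp : 0 ≤ p)
    (hsp : μ {ω | s ω = 1} = ENNReal.ofReal p) :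
    Integrable (fun ω => 1 - s ω) μ ∧ ∫ ω, (1 - s ω) ∂μ = 1 - p := by
  have hm : MeasurableSet {ω | s ω = 1} := hs (measurableSet_singleton 1)
  have hE : s = Set.indicator {ω | s ω = 1} (fun _ => (1 : ℝ)) := by
    funext ω
    by_cases h : s ω = 1
    · simp [Set.indicator, h]
    · simp [Set.indicator, (h01 ω).resolve_right h]
  have hi : Integrable s μ := by
    rw [hE]
    exact (integrable_const 1).indicator hm
  have hv : ∫ ω, s ω ∂μ = p := by
    conv_lhs => rw [hE]
    rw [integral_indicator_const _ hm, measureReal_def, hsp, ENNReal.toReal_ofReal hp]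
    simp
  refine ⟨(integrable_const 1).sub hi, ?_⟩
  rw [integral_sub (integrable_const 1) hi, hv]
  simp

lemma coord_int_aux {Ω : Type*} {m0 : MeasurableSpace Ω} {μ : Measure Ω}
    [IsProbabilityMeasure μ] {d : ℕ} {P : Matrix (Fin d) (Fin d) ℝ} (hs : P.IsSymm)
    (hP : P.PosDef) (e : Ω → Fin d → ℝ) (he : Measurable e)
    (hi : Integrable (fun ω => e ω ⬝ᵥ P.mulVec (e ω)) μ) (i : Fin d) :
    Integrable (fun ω => e ω i) μ ∧ Integrable (fun ω => e ω i ^ 2) μ := by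
  obtain ⟨K, hK, hb⟩ := coord_sq_aux hs hP i
  have hm : Measurable (fun ω => e ω i) := by fun_prop
  have h2 : Integrable (fun ω => e ω i ^ 2) μ := by
    refine (hi.const_mul K).mono' (hm.pow_const 2).aestronglyMeasurable ?_
    filter_upwards with ω
    rw [Real.norm_eq_abs, abs_of_nonneg (sq_nonneg _)]
    exact hb _
  exact ⟨((memLp_two_iff_integrable_sq hm.aestronglyMeasurable).2 h2).integrable (by norm_num), h2⟩

lemma step_aux {Ω : Type*} {m0 : MeasurableSpace Ω} {μ : Measure Ω} [IsProbabilityMeasure μ]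
    {d : ℕ} (A P : Matrix (Fin d) (Fin d) ℝ) (hPsymm : P.IsSymm) (hPposdef : P.PosDef)
    (lam₁ : ℝ) (hLoewner : (lam₁ • P - Aᵀ * P * A).PosSemidef)
    (p : ℝ) (hp0 : 0 < p) (hp1 : p ≤ 1)
    (e v e' : Ω → Fin d → ℝ) (s : Ω → ℝ)
    (he : Measurable e) (hv : Measurable v) (hs : Measurable s)
    (h01 : ∀ ω, s ω = 0 ∨ s ω = 1) (hsp : μ {ω | s ω = 1} = ENNReal.ofReal p)
    (hdyn : ∀ ω, e' ω = (1 - s ω) • (A.mulVec (e ω) + v ω))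
    (hindep : iIndep ![MeasurableSpace.comap s inferInstance,
               MeasurableSpace.comap v inferInstance,
               MeasurableSpace.comap e inferInstance] μ)
    (hv_int : Integrable v μ) (hv_mean : ∫ ω, v ω ∂μ = 0) (C₁ : ℝ)
    (hvP_int : Integrable (fun ω => v ω ⬝ᵥ P.mulVec (v ω)) μ)
    (hvP : ∫ ω, v ω ⬝ᵥ P.mulVec (v ω) ∂μ ≤ C₁)
    (hi : Integrable (fun ω => e ω ⬝ᵥ P.mulVec (e ω)) μ) :
    Integrable (fun ω => e' ω ⬝ᵥ P.mulVec (e' ω)) μ ∧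
    ∫ ω, e' ω ⬝ᵥ P.mulVec (e' ω) ∂μ ≤
      (1 - p) * (lam₁ * ∫ ω, e ω ⬝ᵥ P.mulVec (e ω) ∂μ + C₁) := by
  obtain ⟨hve, hsve⟩ := indep_aux e v s he hv hs hindep
  obtain ⟨hsi, hsE⟩ := one_sub_aux s hs h01 p hp0.le hsp
  have hAi : Integrable (fun ω => A.mulVec (e ω) ⬝ᵥ P.mulVec (A.mulVec (e ω))) μ := by
    have hm := quad_meas_aux A (P * A) he he
    simp only [← mulVec_mulVec] at hm
    refine (hi.const_mul lam₁).mono' hm.aestronglyMeasurable ?_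
    filter_upwards with ω
    rw [Real.norm_eq_abs, abs_of_nonneg (quad_nonneg_aux hPposdef.posSemidef _)]
    exact quad_A_aux hLoewner _
  have hvc : ∀ i, Integrable (fun ω => v ω i) μ := fun i =>
    (coord_int_aux hPsymm hPposdef v hv hvP_int i).1
  have hvm : ∀ i, ∫ ω, v ω i ∂μ = 0 := fun i => by
    rw [← eval_integral hvc, hv_mean]; rfl
  have hwm : ∀ i, Measurable (fun x : Fin d → ℝ => P.mulVec (A.mulVec x) i) := fun i => by
    unfold mulVec dotProduct
    fun_prop
  have hwi : ∀ i, Integrable (fun ω => P.mulVec (A.mulVec (e ω)) i) μ := fun i => by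
    simp only [mulVec_mulVec]
    simp only [mulVec, dotProduct]
    exact integrable_finsetSum _ fun j _ =>
      (coord_int_aux hPsymm hPposdef e he hi j).1.const_mul _
  have hind : ∀ i, IndepFun (fun ω => P.mulVec (A.mulVec (e ω)) i) (fun ω => v ω i) μ :=
    fun i => hve.symm.comp (hwm i) (measurable_pi_apply i)
  have hci : ∀ i, Integrable (fun ω => P.mulVec (A.mulVec (e ω)) i * v ω i) μ := fun i =>
    (hind i).integrable_mul (hwi i) (hvc i)
  have hcross : Integrable (fun ω => P.mulVec (A.mulVec (e ω)) ⬝ᵥ v ω) μ :=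
    integrable_finsetSum _ fun i _ => hci i
  have hcross0 : ∫ ω, P.mulVec (A.mulVec (e ω)) ⬝ᵥ v ω ∂μ = 0 := by
    simp only [dotProduct]
    rw [integral_finsetSum _ fun i _ => hci i]
    refine Finset.sum_eq_zero fun i _ => ?_
    rw [(hind i).integral_fun_mul_eq_mul_integral (hwi i).aestronglyMeasurable
      (hvc i).aestronglyMeasurable, hvm i, mul_zero]
  set g : (Fin d → ℝ) × (Fin d → ℝ) → ℝ := fun z =>
    A.mulVec z.2 ⬝ᵥ P.mulVec (A.mulVec z.2) + 2 * (P.mulVec (A.mulVec z.2) ⬝ᵥ z.1)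
      + z.1 ⬝ᵥ P.mulVec z.1 with hg
  have hgm : Measurable g := by
    rw [hg]
    unfold mulVec dotProduct
    fun_prop
  have hgi : Integrable (fun ω => g (v ω, e ω)) μ :=
    (hAi.add (hcross.const_mul 2)).add hvP_int
  have hgE : ∫ ω, g (v ω, e ω) ∂μ ≤ lam₁ * ∫ ω, e ω ⬝ᵥ P.mulVec (e ω) ∂μ + C₁ := by
    have h1 : ∫ ω, g (v ω, e ω) ∂μ = ∫ ω, A.mulVec (e ω) ⬝ᵥ P.mulVec (A.mulVec (e ω)) ∂μ
        + 2 * ∫ ω, P.mulVec (A.mulVec (e ω)) ⬝ᵥ v ω ∂μ + ∫ ω, v ω ⬝ᵥ P.mulVec (v ω) ∂μ := by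
      rw [← integral_const_mul, ← integral_add hAi (hcross.const_mul 2)]
      exact integral_add (hAi.add (hcross.const_mul 2)) hvP_int
    have h2 := integral_mono hAi (hi.const_mul lam₁) (fun ω => quad_A_aux hLoewner (e ω))
    simp only [integral_const_mul] at h2
    rw [h1, hcross0]
    linarith
  have hI : IndepFun (fun ω => 1 - s ω) (fun ω => g (v ω, e ω)) μ :=
    hsve.comp (φ := fun x : ℝ => 1 - x) (by fun_prop) hgm
  have heq : (fun ω => e' ω ⬝ᵥ P.mulVec (e' ω)) = fun ω => (1 - s ω) * g (v ω, e ω) := by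
    funext ω
    rw [hdyn, quad_smul_aux, quad_add_aux hPsymm]
    rcases h01 ω with h | h <;> simp [h, hg]
  rw [heq]
  refine ⟨hI.integrable_mul hsi hgi, ?_⟩
  rw [hI.integral_fun_mul_eq_mul_integral hsi.aestronglyMeasurable hgi.aestronglyMeasurable, hsE]
  exact mul_le_mul_of_nonneg_left hgE (by linarith)

/-- Contraction estimate for the remote-estimation error under Bernoulli dropouts:
`e_{t+1} = (1 − s_{t+1})(A e_t + v_t)` with `Aᵀ P A ⪯ λ₁ P`, `P(s_{t+1}=1) = p` and
`λ = (1−p)λ₁ < 1` satisfies `E[e_tᵀ P e_t] ≤ λᵗ E[e₀ᵀ P e₀] + C₁/(1−λ)`;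
in particular the process is mean-square bounded. -/
theorem estimation_error_contraction
    {Ω : Type*} {m0 : MeasurableSpace Ω} {μ : Measure Ω} [IsProbabilityMeasure μ]
    {d : ℕ}
    (A : Matrix (Fin d) (Fin d) ℝ)
    (P : Matrix (Fin d) (Fin d) ℝ) (hPsymm : P.IsSymm) (hPposdef : P.PosDef)
    (lam₁ : ℝ) (hlam₁ : 0 < lam₁)
    (hLoewner : (lam₁ • P - Aᵀ * P * A).PosSemidef)
    (p : ℝ) (hp0 : 0 < p) (hp1 : p ≤ 1) (hcontr : (1 - p) * lam₁ < 1)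
    (e v : ℕ → Ω → Fin d → ℝ) (s : ℕ → Ω → ℝ)
    (he_meas : ∀ t, Measurable (e t)) (hv_meas : ∀ t, Measurable (v t))
    (hs_meas : ∀ t, Measurable (s t))
    (hs01 : ∀ t, ∀ ω, s (t + 1) ω = 0 ∨ s (t + 1) ω = 1)
    (hsp : ∀ t : ℕ, μ {ω | s (t + 1) ω = 1} = ENNReal.ofReal p)
    (hdyn : ∀ t ω, e (t + 1) ω = (1 - s (t + 1) ω) • (A.mulVec (e t ω) + v t ω))
    (hindep : ∀ t : ℕ,
      iIndep ![MeasurableSpace.comap (s (t + 1)) inferInstance,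
               MeasurableSpace.comap (v t) inferInstance,
               MeasurableSpace.comap (e t) inferInstance] μ)
    (hv_int : ∀ t, Integrable (v t) μ)
    (hv_mean : ∀ t, ∫ ω, v t ω ∂μ = 0)
    (C₁ : ℝ)
    (hvP_int : ∀ t, Integrable (fun ω => v t ω ⬝ᵥ P.mulVec (v t ω)) μ)
    (hvP : ∀ t, ∫ ω, v t ω ⬝ᵥ P.mulVec (v t ω) ∂μ ≤ C₁)
    (he0_int : Integrable (fun ω => e 0 ω ⬝ᵥ P.mulVec (e 0 ω)) μ) :
    (∀ t : ℕ, ∫ ω, e t ω ⬝ᵥ P.mulVec (e t ω) ∂μ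
        ≤ ((1 - p) * lam₁) ^ t * ∫ ω, e 0 ω ⬝ᵥ P.mulVec (e 0 ω) ∂μ
          + C₁ / (1 - (1 - p) * lam₁)) ∧
      ∃ S : ℝ, ∀ t : ℕ, ∫ ω, ∑ i, (e t ω i) ^ 2 ∂μ ≤ S := by
  have hint : ∀ t, Integrable (fun ω => e t ω ⬝ᵥ P.mulVec (e t ω)) μ := by
    intro t
    induction t with
    | zero => exact he0_int
    | succ t ih =>
      exact (step_aux A P hPsymm hPposdef lam₁ hLoewner p hp0 hp1 (e t) (v t) (e (t + 1))
        (s (t + 1)) (he_meas t) (hv_meas t) (hs_meas _) (hs01 t) (hsp t) (hdyn t) (hindep t)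
        (hv_int t) (hv_mean t) C₁ (hvP_int t) (hvP t) ih).1
  have hstep := fun t =>
      (step_aux A P hPsymm hPposdef lam₁ hLoewner p hp0 hp1 (e t) (v t) (e (t + 1))
        (s (t + 1)) (he_meas t) (hv_meas t) (hs_meas _) (hs01 t) (hsp t) (hdyn t) (hindep t)
        (hv_int t) (hv_mean t) C₁ (hvP_int t) (hvP t) (hint t)).2
  have hC : 0 ≤ C₁ :=
    (integral_nonneg fun ω => quad_nonneg_aux hPposdef.posSemidef (v 0 ω)).trans (hvP 0)
  have hE0 : 0 ≤ ∫ ω, e 0 ω ⬝ᵥ P.mulVec (e 0 ω) ∂μ :=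
    integral_nonneg fun ω => quad_nonneg_aux hPposdef.posSemidef (e 0 ω)
  have hl0 : 0 ≤ (1 - p) * lam₁ := mul_nonneg (by linarith) hlam₁.le
  have hpos : 0 < 1 - (1 - p) * lam₁ := by linarith
  have hmain : ∀ t : ℕ, ∫ ω, e t ω ⬝ᵥ P.mulVec (e t ω) ∂μ
        ≤ ((1 - p) * lam₁) ^ t * ∫ ω, e 0 ω ⬝ᵥ P.mulVec (e 0 ω) ∂μ
          + C₁ / (1 - (1 - p) * lam₁) := by
    intro t
    induction t with
    | zero =>
      have := div_nonneg hC hpos.le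
      simpa using this
    | succ t ih =>
      have h1 := hstep t
      have h2 := mul_le_mul_of_nonneg_left ih hl0
      have h3 : (1 - p) * C₁ ≤ C₁ := by nlinarith
      have h4 : C₁ / (1 - (1 - p) * lam₁) * (1 - (1 - p) * lam₁) = C₁ :=
        div_mul_cancel₀ _ hpos.ne'
      rw [pow_succ]
      nlinarith
  refine ⟨hmain, ?_⟩
  choose K hK hb using fun i => coord_sq_aux hPsymm hPposdef i
  refine ⟨(∑ i, K i) * (∫ ω, e 0 ω ⬝ᵥ P.mulVec (e 0 ω) ∂μ + C₁ / (1 - (1 - p) * lam₁)),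
    fun t => ?_⟩
  have hle : ∫ ω, ∑ i, (e t ω i) ^ 2 ∂μ ≤ ∫ ω, (∑ i, K i) * (e t ω ⬝ᵥ P.mulVec (e t ω)) ∂μ := by
    refine integral_mono (integrable_finsetSum _ fun i _ =>
      (coord_int_aux hPsymm hPposdef (e t) (he_meas t) (hint t) i).2)
      ((hint t).const_mul _) fun ω => ?_
    simp only [Finset.sum_mul]
    exact Finset.sum_le_sum fun i _ => hb i _
  rw [integral_const_mul] at hle
  refine hle.trans (mul_le_mul_of_nonneg_left ((hmain t).trans ?_)
    (Finset.sum_nonneg fun i _ => hK i))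
  have := mul_le_of_le_one_left hE0 (pow_le_one₀ (n := t) hl0 hcontr.le)
  linarith
end
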